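/- Under the same assumptions, constants, step size α = √(2(Δ + 2 L_f L_y μ)/(T L_F σ²)), and random iterates x_{t+1} = x_t − α g_t as in the previous statement (with g_t built from i.i.d. uniform sphere directions v_t), the averaged expected squared gradient norm of the smoothed surrogate satisfies (1/T) Σ_{t=0}^{T−1} E[‖∇F_μ(x_t)‖²] ≤ 2√(2(Δ + 2 L_f L_y μ) L_F σ² / T) + C_p² μ², where C_p = L_g(1+L_y)L_y, L_F = L_g(1+L_y)² + k₁ L_f L_y √d_x/μ, and σ² = k₂ d_x L_f² L_y² + L_f²(1+2L_y). -/

import Mathlib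

open MeasureTheory Metric
open scoped InnerProductSpace RealInnerProductSpace NNReal

noncomputable section

/-- `ℝ^n` with the Euclidean norm. -/
abbrev E (n : ℕ) : Type := EuclideanSpace ℝ (Fin n)

/-- Uniform (normalized Lebesgue) probability measure on the closed unit ball of `ℝ^n`. -/
def uniformBall (n : ℕ) : Measure (E n) :=
  (volume (closedBall (0 : E n) 1))⁻¹ • volume.restrict (closedBall (0 : E n) 1)

/-- Uniform (rotation-invariant) probability measure on the unit sphere of `ℝ^n`,
viewed as a measure on the ambient space. -/
def uniformSphere (n : ℕ) : Measure (E n) :=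
  ((volume : Measure (E n)).toSphere Set.univ)⁻¹ •
    Measure.map Subtype.val ((volume : Measure (E n)).toSphere)

/-- Ball smoothing `y_μ` of a map `y : ℝ^{d_x} → ℝ^{d_y}`:
`y_μ(x) = E_{u ~ U(B^{d_x})}[y(x + μ u)]`. -/
def ymu {dx dy : ℕ} (y : E dx → E dy) (μ : ℝ) (x : E dx) : E dy :=
  ∫ u, y (x + μ • u) ∂(uniformBall dx)

/-- Partial gradient `∇_x f` of `f : ℝ^{d_x} × ℝ^{d_y} → ℝ` in its first argument. -/
def gradx {dx dy : ℕ} (f : E dx × E dy → ℝ) (x : E dx) (y : E dy) : E dx :=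
  gradient (fun x' => f (x', y)) x

/-- Partial gradient `∇_y f` of `f : ℝ^{d_x} × ℝ^{d_y} → ℝ` in its second argument. -/
def grady {dx dy : ℕ} (f : E dx × E dy → ℝ) (x : E dx) (y : E dy) : E dy :=
  gradient (fun y' => f (x, y')) y

/-- Smoothed surrogate `F_μ(x) = f(x, y_μ(x))`. -/
def Fmu {dx dy : ℕ} (f : E dx × E dy → ℝ) (y : E dx → E dy) (μ : ℝ) (x : E dx) : ℝ :=
  f (x, ymu y μ x)

section Polar
variable {V : Type*} [NormedAddCommGroup V] [InnerProductSpace ℝ V] [FiniteDimensional ℝ V]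
  [MeasurableSpace V] [BorelSpace V] [Nontrivial V] (ν : Measure V) [ν.IsAddHaarMeasure]

theorem integral_eq_integral_Ioi_integral_toSphere {G : V → ℝ} (hG : Integrable G ν) :
    ∫ x, G x ∂ν = ∫ r in Set.Ioi (0 : ℝ),
      r ^ (Module.finrank ℝ V - 1) * ∫ v, G (r • (v : V)) ∂ν.toSphere := by
  have hmp := ν.measurePreserving_homeomorphUnitSphereProd
  have hemb := (homeomorphUnitSphereProd V).measurableEmbedding
  have hGeq : ∀ x : ({(0)}ᶜ : Set V), G x = (fun p : sphere (0 : V) 1 × Set.Ioi (0 : ℝ) =>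
      G (p.2.1 • p.1.1)) (homeomorphUnitSphereProd V x) := by
    intro x
    have := (homeomorphUnitSphereProd_symm_apply_coe V (homeomorphUnitSphereProd V x)).symm
    simp only [Homeomorph.symm_apply_apply] at this
    simp only [this]
  have hInt : Integrable (fun p : sphere (0 : V) 1 × Set.Ioi (0 : ℝ) => G (p.2.1 • p.1.1))
      (ν.toSphere.prod (.volumeIoiPow (Module.finrank ℝ V - 1))) := by
    rw [← hmp.integrable_comp_emb hemb]
    have h1 : IntegrableOn G ({(0)}ᶜ : Set V) ν := hG.integrableOn
    rw [integrableOn_iff_comap_subtypeVal (measurableSet_singleton _).compl] at h1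
    refine h1.congr (.of_forall fun x => ?_)
    exact hGeq x
  calc ∫ x, G x ∂ν = ∫ x : ({(0)}ᶜ : Set V), G x ∂(ν.comap (↑)) := by
        rw [integral_subtype_comap (measurableSet_singleton _).compl fun x ↦ G x,
          restrict_compl_singleton]
    _ = ∫ p : sphere (0 : V) 1 × Set.Ioi (0 : ℝ), G (p.2.1 • p.1.1)
          ∂(ν.toSphere.prod (.volumeIoiPow (Module.finrank ℝ V - 1))) := by
        rw [← hmp.integral_comp hemb]
        exact integral_congr_ae (.of_forall hGeq)
    _ = ∫ r : Set.Ioi (0 : ℝ), (∫ v, G (r.1 • (v : V)) ∂ν.toSphere)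
          ∂(.volumeIoiPow (Module.finrank ℝ V - 1)) := integral_prod_symm _ hInt
    _ = _ := by
      simp only [Measure.volumeIoiPow, ENNReal.ofReal]
      rw [integral_withDensity_eq_integral_smul,
        integral_subtype_comap measurableSet_Ioi fun a : ℝ ↦
          Real.toNNReal (a ^ (Module.finrank ℝ V - 1)) • ∫ v, G (a • (v : V)) ∂ν.toSphere]
      · refine setIntegral_congr_fun measurableSet_Ioi fun x hx ↦ ?_
        simp only [NNReal.smul_def, Real.coe_toNNReal _ (pow_nonneg (le_of_lt hx) _), smul_eq_mul]
      · exact (measurable_subtype_coe.pow_const _).real_toNNReal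

theorem lineDeriv_max_sub_norm {V : Type*} [NormedAddCommGroup V] [InnerProductSpace ℝ V]
    {R : ℝ} {x : V} (e : V) (hx0 : x ≠ 0) (hxR : ‖x‖ ≠ R) :
    lineDeriv ℝ (fun x : V => max (R - ‖x‖) 0) x (-e)
      = (ball (0 : V) R).indicator (fun x => ⟪x, e⟫ / ‖x‖) x := by
  rcases lt_or_gt_of_ne hxR with h | h
  · have h1 : (fun x : V => max (R - ‖x‖) 0) =ᶠ[nhds x] fun x => R - ‖x‖ := by
      filter_upwards [continuous_norm.continuousAt.eventually_lt continuousAt_const h] with z hz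
      exact max_eq_left (by linarith)
    have hd : HasFDerivAt (fun x : V => R - ‖x‖) (-(‖x‖⁻¹ • innerSL ℝ x)) x := by
      have h2 : HasFDerivAt (fun x : V => ‖x‖) (‖x‖⁻¹ • innerSL ℝ x) x := by
        have h3 := ((hasStrictFDerivAt_norm_sq x).hasFDerivAt).sqrt (by simpa using hx0)
        simp only [Real.sqrt_sq (norm_nonneg _)] at h3
        convert h3 using 1
        ext y
        simp
        field_simp
      exact h2.const_sub R
    rw [(hd.congr_of_eventuallyEq h1).hasLineDerivAt (-e) |>.lineDeriv,
      Set.indicator_of_mem (by simpa using h)]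
    simp [div_eq_inv_mul]
  · have h1 : (fun x : V => max (R - ‖x‖) 0) =ᶠ[nhds x] fun x => 0 := by
      filter_upwards [continuousAt_const.eventually_lt continuous_norm.continuousAt h] with z hz
      exact max_eq_right (by linarith)
    rw [((hasFDerivAt_const (0 : ℝ) x).congr_of_eventuallyEq h1).hasLineDerivAt (-e) |>.lineDeriv,
      Set.indicator_of_notMem (by simpa using h.le)]
    simp

theorem integral_ball_inner_div_norm {k : V → ℝ} (hk : Continuous k) (e : V) {R : ℝ} (hR : 0 ≤ R) :
    ∫ x, (ball (0 : V) R).indicator (fun x => ⟪x, e⟫ / ‖x‖) x * k x ∂ν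
      = ∫ r in (0 : ℝ)..R, r ^ (Module.finrank ℝ V - 1) *
          ∫ v, ⟪(v : V), e⟫ * k (r • (v : V)) ∂ν.toSphere := by
  have hInt : Integrable (fun x => (ball (0 : V) R).indicator (fun x => ⟪x, e⟫ / ‖x‖) x * k x) ν := by
    have h1 : IntegrableOn (fun x => (⟪x, e⟫ / ‖x‖) * k x) (ball (0 : V) R) ν := by
      have h2 : IntegrableOn k (ball (0 : V) R) ν :=
        (hk.continuousOn.integrableOn_compact (isCompact_closedBall (0 : V) R)).mono_set
          ball_subset_closedBall
      refine Integrable.bdd_mul (c := ‖e‖) h2 ?_ ?_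
      · have : Measurable fun x : V => ⟪x, e⟫ / ‖x‖ := by fun_prop
        exact this.aestronglyMeasurable
      · refine .of_forall fun x => ?_
        rw [norm_div, norm_norm]
        refine div_le_of_le_mul₀ (norm_nonneg _) (norm_nonneg _) ?_
        rw [mul_comm]; exact norm_inner_le_norm x e
    rw [← integrable_indicator_iff measurableSet_ball] at h1
    refine h1.congr (.of_forall fun x => ?_)
    by_cases hx : x ∈ ball (0 : V) R
    · simp only [Set.indicator_of_mem hx]
    · simp only [Set.indicator_of_notMem hx, zero_mul]
  rw [integral_eq_integral_Ioi_integral_toSphere ν hInt, intervalIntegral.integral_of_le hR,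
    integral_Ioc_eq_integral_Ioo, ← integral_indicator measurableSet_Ioi,
    ← integral_indicator measurableSet_Ioo]
  congr 1
  ext r
  by_cases hr : 0 < r
  · rw [Set.indicator_of_mem (Set.mem_Ioi.2 hr)]
    by_cases hrR : r < R
    · rw [Set.indicator_of_mem (Set.mem_Ioo.2 ⟨hr, hrR⟩)]
      congr 2
      ext v
      rw [Set.indicator_of_mem (by simp [norm_smul, abs_of_pos hr, hrR])]
      have hv : ‖(v : V)‖ = 1 := by simp
      rw [norm_smul, Real.norm_of_nonneg hr.le, hv, mul_one, real_inner_smul_left,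
        mul_div_cancel_left₀ _ hr.ne']
    · rw [Set.indicator_of_notMem (fun h => hrR h.2)]
      rw [integral_eq_zero_of_ae, mul_zero]
      refine .of_forall fun v => ?_
      simp only [Pi.zero_apply]
      rw [Set.indicator_of_notMem (by simpa [norm_smul, abs_of_pos hr, -not_lt] using hrR), zero_mul]
  · rw [Set.indicator_of_notMem (by simpa using hr), Set.indicator_of_notMem (fun h => hr h.1)]

theorem LipschitzWith.setIntegral_ball_lineDeriv {k : V → ℝ} {L : ℝ≥0} (hk : LipschitzWith L k)
    (e : V) : ∫ x in ball (0 : V) 1, lineDeriv ℝ k x e ∂ν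
      = ∫ v, ⟪(v : V), e⟫ * k (v : V) ∂ν.toSphere := by
  set d := Module.finrank ℝ V - 1
  set A : ℝ → ℝ := fun R => ∫ x, lineDeriv ℝ k x e * max (R - ‖x‖) 0 ∂ν with hA
  set M : ℝ → ℝ := fun r => r ^ d * ∫ v, ⟪(v : V), e⟫ * k (r • (v : V)) ∂ν.toSphere with hM
  have hMc : Continuous M := by
    refine (continuous_pow d).mul ?_
    have hkc := hk.continuous
    have h1 : Continuous (Function.uncurry fun (r : ℝ) (v : sphere (0 : V) 1) =>
        ⟪(v : V), e⟫ * k (r • (v : V))) := by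
      simp only [Function.uncurry_def]
      fun_prop
    simpa using continuous_parametric_integral_of_continuous (μ := ν.toSphere) h1
      (isCompact_univ (X := sphere (0 : V) 1))
  have hAM : ∀ R, 0 ≤ R → A R = ∫ r in (0 : ℝ)..R, M r := by
    intro R hR
    have hl : LipschitzWith 1 (fun x : V => max (R - ‖x‖) 0) := by
      have := (LipschitzWith.const (α := V) R).sub lipschitzWith_one_norm
      simpa using this.max_const 0
    have hcs : HasCompactSupport (fun x : V => max (R - ‖x‖) 0) := by
      refine HasCompactSupport.intro (isCompact_closedBall (0 : V) R) fun x hx => ?_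
      simp at hx
      exact max_eq_right (by linarith)
    rw [hA]
    simp only
    rw [hk.integral_lineDeriv_mul_eq hl hcs, ← integral_ball_inner_div_norm ν hk.continuous e hR]
    refine integral_congr_ae ?_
    have h0 : ∀ᵐ x ∂ν, x ≠ 0 := by simp [ae_iff]
    have h1 : ∀ᵐ x ∂ν, ‖x‖ ≠ R := by
      have := Measure.addHaar_sphere ν (0 : V) R
      rw [ae_iff]
      convert this using 2
      ext x; simp
    filter_upwards [h0, h1] with x hx0 hx1
    rw [lineDeriv_max_sub_norm e hx0 hx1]
  have hd1 : HasDerivAt A (M 1) 1 := by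
    have h1 : HasDerivAt (fun R => ∫ r in (0 : ℝ)..R, M r) (M 1) 1 :=
      intervalIntegral.integral_hasDerivAt_right (hMc.intervalIntegrable _ _)
        (hMc.stronglyMeasurableAtFilter _ _) hMc.continuousAt
    refine h1.congr_of_eventuallyEq ?_
    filter_upwards [lt_mem_nhds (zero_lt_one' ℝ)] with R hR
    exact hAM R hR.le
  have hmeas : AEStronglyMeasurable (fun x => lineDeriv ℝ k x e) ν :=
    (measurable_lineDeriv hk.continuous).aestronglyMeasurable
  have hbd : ∀ x, ‖lineDeriv ℝ k x e‖ ≤ L * ‖e‖ := fun x =>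
    norm_lineDeriv_le_of_lipschitz ℝ hk
  have hd2 : HasDerivAt A (∫ x, (ball (0 : V) 1).indicator (fun x => lineDeriv ℝ k x e) x ∂ν) 1 := by
    refine (hasDerivAt_integral_of_dominated_loc_of_lip (s := ball (1 : ℝ) 1)
      (bound := (closedBall (0 : V) 2).indicator fun _ => L * ‖e‖)
      (ball_mem_nhds _ one_pos) ?_ ?_ ?_ ?_ ?_ ?_).2
    · refine .of_forall fun R => hmeas.mul ?_
      exact Continuous.aestronglyMeasurable (by fun_prop)
    · refine Integrable.bdd_mul (c := L * ‖e‖) ?_ hmeas (.of_forall hbd)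
      refine Continuous.integrable_of_hasCompactSupport (by fun_prop) ?_
      refine HasCompactSupport.intro (isCompact_closedBall (0 : V) 1) fun x hx => ?_
      simp at hx
      exact max_eq_right (by linarith)
    · exact hmeas.indicator measurableSet_ball
    · refine .of_forall fun x => ?_
      refine LipschitzOnWith.of_dist_le_mul fun R hR S hS => ?_
      simp only [Real.coe_nnabs, Real.dist_eq, ← mul_sub, abs_mul]
      simp only [mem_ball, Real.dist_eq, abs_lt] at hR hS
      by_cases hx : ‖x‖ ≤ 2
      · rw [Set.indicator_of_mem (by simpa using hx), abs_of_nonneg (by positivity : 0 ≤ L * ‖e‖)]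
        refine mul_le_mul (hbd x) ?_ (abs_nonneg _) (by positivity)
        refine (abs_max_sub_max_le_abs _ _ _).trans ?_
        rw [sub_sub_sub_cancel_right]
      · rw [max_eq_right (by linarith), max_eq_right (by linarith), sub_zero, abs_zero, mul_zero]
        positivity
    · rw [integrable_indicator_iff measurableSet_closedBall]
      exact integrableOn_const (measure_closedBall_lt_top.ne)
    · have h1 : ∀ᵐ x ∂ν, ‖x‖ ≠ 1 := by
        have := Measure.addHaar_sphere ν (0 : V) 1
        rw [ae_iff]
        convert this using 2
        ext x; simp
      filter_upwards [h1] with x hx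
      rcases lt_or_gt_of_ne hx with h | h
      · rw [Set.indicator_of_mem (by simpa using h)]
        have h2 : HasDerivAt (fun R => lineDeriv ℝ k x e * (R - ‖x‖)) (lineDeriv ℝ k x e) 1 := by
          simpa using ((hasDerivAt_id (1 : ℝ)).sub_const ‖x‖).const_mul (lineDeriv ℝ k x e)
        refine h2.congr_of_eventuallyEq ?_
        filter_upwards [lt_mem_nhds h] with R hR
        rw [max_eq_left (by linarith)]
      · rw [Set.indicator_of_notMem (by simpa using h.le)]
        refine (hasDerivAt_const (1 : ℝ) (0 : ℝ)).congr_of_eventuallyEq ?_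
        filter_upwards [gt_mem_nhds h] with R hR
        rw [max_eq_right (by linarith), mul_zero]
  rw [← integral_indicator measurableSet_ball, hd2.unique hd1]
  simp [hM]
end Polar

section UniformMeasures

instance isProbabilityMeasure_uniformBall (n : ℕ) : IsProbabilityMeasure (uniformBall n) := by
  refine ⟨?_⟩
  rw [uniformBall, Measure.smul_apply, Measure.restrict_apply_univ, smul_eq_mul]
  exact ENNReal.inv_mul_cancel (measure_closedBall_pos _ _ one_pos).ne' measure_closedBall_lt_top.ne

instance isFiniteMeasure_uniformSphere (n : ℕ) : IsFiniteMeasure (uniformSphere n) := by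
  refine ⟨?_⟩
  rw [uniformSphere, Measure.smul_apply, Measure.map_apply measurable_subtype_coe .univ,
    Set.preimage_univ, smul_eq_mul]
  exact (ENNReal.inv_mul_le_one _).trans_lt ENNReal.one_lt_top

theorem isProbabilityMeasure_uniformSphere {n : ℕ} (hn : n ≠ 0) :
    IsProbabilityMeasure (uniformSphere n) := by
  have : Nontrivial (E n) := by
    have : NeZero n := ⟨hn⟩
    infer_instance
  refine ⟨?_⟩
  rw [uniformSphere, Measure.smul_apply, Measure.map_apply measurable_subtype_coe .univ,
    Set.preimage_univ, smul_eq_mul]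
  refine ENNReal.inv_mul_cancel ?_ (measure_ne_top _ _)
  rw [Measure.measure_univ_ne_zero]
  exact Measure.toSphere_ne_zero _

theorem ae_mem_closedBall_uniformBall (n : ℕ) :
    ∀ᵐ u ∂(uniformBall n), u ∈ closedBall (0 : E n) 1 := by
  rw [uniformBall]
  exact Measure.ae_smul_measure (ae_restrict_mem measurableSet_closedBall) _

theorem ae_mem_sphere_uniformSphere (n : ℕ) :
    ∀ᵐ v ∂(uniformSphere n), v ∈ sphere (0 : E n) 1 := by
  rw [uniformSphere]
  refine Measure.ae_smul_measure ?_ _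
  exact (ae_map_iff (p := (· ∈ sphere (0 : E n) 1)) measurable_subtype_coe.aemeasurable
    isClosed_sphere.measurableSet).2 (.of_forall fun v => v.2)

theorem ae_uniformBall_of_ae_volume {n : ℕ} {p : E n → Prop} (h : ∀ᵐ u, p u) :
    ∀ᵐ u ∂(uniformBall n), p u := by
  rw [uniformBall]
  exact Measure.ae_smul_measure (ae_restrict_of_ae h) _

theorem integrable_of_ae_mem_isCompact {X G : Type*} [TopologicalSpace X] [T2Space X]
    [MeasurableSpace X] [BorelSpace X] [NormedAddCommGroup G] {ν : Measure X} [IsFiniteMeasure ν]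
    {K : Set X} (hK : IsCompact K) (hν : ∀ᵐ x ∂ν, x ∈ K) {φ : X → G} (hφ : Continuous φ)
    [SecondCountableTopology X] [TopologicalSpace.PseudoMetrizableSpace X] :
    Integrable φ ν := by
  have : IntegrableOn φ K ν := hφ.continuousOn.integrableOn_of_subset_isCompact hK
    hK.measurableSet subset_rfl (measure_ne_top _ _)
  rwa [IntegrableOn, Measure.restrict_eq_self_of_ae_mem hν] at this

theorem integrable_uniformBall {n : ℕ} {G : Type*} [NormedAddCommGroup G] {φ : E n → G}
    (hφ : Continuous φ) : Integrable φ (uniformBall n) :=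
  integrable_of_ae_mem_isCompact (isCompact_closedBall _ _) (ae_mem_closedBall_uniformBall n) hφ

theorem integrable_uniformSphere {n : ℕ} {G : Type*} [NormedAddCommGroup G] {φ : E n → G}
    (hφ : Continuous φ) : Integrable φ (uniformSphere n) :=
  integrable_of_ae_mem_isCompact (isCompact_sphere _ _) (ae_mem_sphere_uniformSphere n) hφ

theorem integral_uniformSphere {n : ℕ} (φ : E n → ℝ) :
    ∫ v, φ v ∂(uniformSphere n) = (n * volume.real (ball (0 : E n) 1))⁻¹ *
      ∫ v : sphere (0 : E n) 1, φ v ∂(volume : Measure (E n)).toSphere := by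
  rw [uniformSphere, integral_smul_measure, (MeasurableEmbedding.subtype_coe
    isClosed_sphere.measurableSet).integral_map, smul_eq_mul, ENNReal.toReal_inv]
  congr 2
  simp [Measure.real]

theorem integral_uniformBall {n : ℕ} (hn : n ≠ 0) (φ : E n → ℝ) :
    ∫ u, φ u ∂(uniformBall n) = (volume.real (ball (0 : E n) 1))⁻¹ *
      ∫ u in ball (0 : E n) 1, φ u := by
  have : Nontrivial (E n) := by
    have : NeZero n := ⟨hn⟩
    infer_instance
  have hae : ball (0 : E n) 1 =ᵐ[volume] closedBall 0 1 :=
    ae_eq_of_subset_of_measure_ge ball_subset_closedBall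
      (Measure.addHaar_closedBall_eq_addHaar_ball _ _ _).le measurableSet_ball.nullMeasurableSet
      measure_closedBall_lt_top.ne
  rw [uniformBall, integral_smul_measure, smul_eq_mul, ENNReal.toReal_inv,
    Measure.addHaar_closedBall_eq_addHaar_ball, ← Measure.restrict_congr_set hae]
  rfl

end UniformMeasures

section Smoothing

variable {n : ℕ}

theorem LipschitzWith.comp_add_smul {G : Type*} [NormedAddCommGroup G] {h : E n → G} {L : ℝ≥0}
    (hh : LipschitzWith L h) (x : E n) (c : ℝ) :
    LipschitzWith (L * ‖c‖₊) fun u => h (x + c • u) := by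
  refine hh.comp (LipschitzWith.of_dist_le_mul fun u v => ?_)
  rw [dist_add_left, dist_smul₀, coe_nnnorm]

theorem LipschitzWith.ae_differentiableAt_add_smul {G : Type*} [NormedAddCommGroup G]
    [NormedSpace ℝ G] [FiniteDimensional ℝ G] {h : E n → G} {L : ℝ≥0} (hh : LipschitzWith L h)
    (x : E n) {c : ℝ} (hc : c ≠ 0) : ∀ᵐ u : E n, DifferentiableAt ℝ h (x + c • u) := by
  filter_upwards [(hh.comp_add_smul x c).ae_differentiableAt (μ := volume)] with u hu
  have h1 : h = (fun u => h (x + c • u)) ∘ fun z => c⁻¹ • (z - x) := by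
    ext z
    simp [smul_smul, hc]
  rw [h1]
  refine DifferentiableAt.comp _ ?_ (by fun_prop)
  simpa [smul_smul, hc] using hu

theorem LipschitzWith.hasFDerivAt_integral_uniformBall {G : Type*} [NormedAddCommGroup G]
    [NormedSpace ℝ G] [FiniteDimensional ℝ G] {h : E n → G} {L : ℝ≥0} (hh : LipschitzWith L h)
    {c : ℝ} (hc : c ≠ 0) (x : E n) :
    Integrable (fun u => fderiv ℝ h (x + c • u)) (uniformBall n) ∧
    HasFDerivAt (fun z => ∫ u, h (z + c • u) ∂(uniformBall n))
      (∫ u, fderiv ℝ h (x + c • u) ∂(uniformBall n)) x := by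
  have hc' := hh.continuous
  borelize G
  refine hasFDerivAt_integral_of_dominated_loc_of_lip (s := Set.univ) (bound := fun _ => (L : ℝ))
    Filter.univ_mem (.of_forall fun z => ?_) (integrable_uniformBall (by fun_prop)) ?_
    (.of_forall fun u => ?_) (integrable_const _) ?_
  · exact (integrable_uniformBall (by fun_prop)).aestronglyMeasurable
  · exact ((measurable_fderiv ℝ h).comp (by fun_prop)).aestronglyMeasurable
  · rw [lipschitzOnWith_univ]
    refine LipschitzWith.of_dist_le_mul fun a b => (hh.dist_le_mul _ _).trans ?_
    simp
  · filter_upwards [ae_uniformBall_of_ae_volume (hh.ae_differentiableAt_add_smul x hc)] with u hu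
    exact (hasFDerivAt_comp_add_right (c • u)).2 hu.hasFDerivAt

theorem LipschitzWith.fderiv_integral_uniformBall_apply {h : E n → ℝ} {L : ℝ≥0}
    (hh : LipschitzWith L h) {c : ℝ} (hc : c ≠ 0) (hn : n ≠ 0) (x e : E n) :
    fderiv ℝ (fun z => ∫ u, h (z + c • u) ∂(uniformBall n)) x e
      = ∫ v, (n / (2 * c) * (h (x + c • v) - h (x - c • v))) * ⟪v, e⟫ ∂(uniformSphere n) := by
  have : Nontrivial (E n) := by
    have : NeZero n := ⟨hn⟩
    infer_instance
  have hcont := hh.continuous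
  obtain ⟨hi, hd⟩ := hh.hasFDerivAt_integral_uniformBall hc x
  have key : ∀ b : ℝ, b ≠ 0 → ∫ u in ball (0 : E n) 1, fderiv ℝ h (x + b • u) e
      = b⁻¹ * ∫ v : sphere (0 : E n) 1, ⟪(v : E n), e⟫ * h (x + b • (v : E n))
        ∂(volume : Measure (E n)).toSphere := by
    intro b hb
    rw [← (hh.comp_add_smul x b).setIntegral_ball_lineDeriv volume e, ← integral_const_mul]
    refine integral_congr_ae (ae_restrict_of_ae ?_)
    filter_upwards [hh.ae_differentiableAt_add_smul x hb] with u hu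
    have h1 : HasFDerivAt (fun u : E n => x + b • u) (b • ContinuousLinearMap.id ℝ (E n)) u :=
      ((hasFDerivAt_id u).const_smul b).const_add x
    have h2 := (hu.hasFDerivAt.comp u h1).hasLineDerivAt e |>.lineDeriv
    simp only [Function.comp_def] at h2
    rw [h2]
    simp [hb]
  have hneg : ∫ u in ball (0 : E n) 1, fderiv ℝ h (x + (-c) • u) e
      = ∫ u in ball (0 : E n) 1, fderiv ℝ h (x + c • u) e := by
    have h1 := (Measure.measurePreserving_neg (volume : Measure (E n))).setIntegral_preimage_emb
      (MeasurableEquiv.neg (E n)).measurableEmbedding (fun u => fderiv ℝ h (x + c • u) e)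
      (ball (0 : E n) 1)
    rw [← h1]
    have h2 : (fun u : E n => -u) ⁻¹' ball (0 : E n) 1 = ball 0 1 := by
      ext u; simp
    rw [h2]
    simp
  have hInt : ∀ b : ℝ, Integrable (fun v : sphere (0 : E n) 1 =>
      ⟪(v : E n), e⟫ * h (x + b • (v : E n))) (volume : Measure (E n)).toSphere := fun b =>
    integrable_of_ae_mem_isCompact isCompact_univ (by simp) (by fun_prop)
  rw [hd.fderiv, ContinuousLinearMap.integral_apply hi, integral_uniformBall hn, integral_uniformSphere]
  have h3 : ∫ v : sphere (0 : E n) 1, (n / (2 * c) * (h (x + c • (v : E n)) - h (x - c • (v : E n))))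
      * ⟪(v : E n), e⟫ ∂(volume : Measure (E n)).toSphere
      = n * (2 * c)⁻¹ * (∫ v : sphere (0 : E n) 1, ⟪(v : E n), e⟫ * h (x + c • (v : E n))
          ∂(volume : Measure (E n)).toSphere
        - ∫ v : sphere (0 : E n) 1, ⟪(v : E n), e⟫ * h (x + (-c) • (v : E n))
          ∂(volume : Measure (E n)).toSphere) := by
    rw [← integral_sub (hInt _) (hInt _), ← integral_const_mul]
    congr 1
    ext v
    rw [neg_smul, ← sub_eq_add_neg]
    ring
  have h4 := key c hc
  have h5 := key (-c) (neg_ne_zero.2 hc)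
  rw [hneg] at h5
  rw [h3]
  have hn' : (n : ℝ) ≠ 0 := by exact_mod_cast hn
  have hI : ∀ A P Q : ℝ, A = c⁻¹ * P → A = (-c)⁻¹ * Q → A = (2 * c)⁻¹ * (P - Q) := by
    intro A P Q h h'
    have hP : P = c * A := by rw [h]; field_simp
    have hQ : Q = -c * A := by rw [h']; field_simp
    rw [hP, hQ]; field_simp; ring
  rw [hI _ _ _ h4 h5]
  field_simp

end Smoothing
section SmoothedResponse

variable {dx dy : ℕ}

theorem inner_gradx {f : E dx × E dy → ℝ} (hf : Differentiable ℝ f) (x : E dx) (y : E dy)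
    (e : E dx) : ⟪gradx f x y, e⟫ = fderiv ℝ f (x, y) (e, 0) := by
  rw [gradx, inner_gradient_left]
  have h : HasFDerivAt (fun x' => f (x', y))
      ((fderiv ℝ f (x, y)).comp (ContinuousLinearMap.inl ℝ (E dx) (E dy))) x :=
    (hf (x, y)).hasFDerivAt.comp x (hasFDerivAt_prodMk_left x y)
  rw [h.fderiv]
  rfl

theorem inner_grady {f : E dx × E dy → ℝ} (hf : Differentiable ℝ f) (x : E dx) (y : E dy)
    (e : E dy) : ⟪grady f x y, e⟫ = fderiv ℝ f (x, y) (0, e) := by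
  rw [grady, inner_gradient_left]
  have h : HasFDerivAt (fun y' => f (x, y'))
      ((fderiv ℝ f (x, y)).comp (ContinuousLinearMap.inr ℝ (E dx) (E dy))) y :=
    (hf (x, y)).hasFDerivAt.comp y (hasFDerivAt_prodMk_right x y)
  rw [h.fderiv]
  rfl

theorem norm_le_of_forall_inner_le {V : Type*} [NormedAddCommGroup V] [InnerProductSpace ℝ V]
    {a : V} {c : ℝ} (hc : 0 ≤ c) (h : ∀ e, ⟪a, e⟫ ≤ c * ‖e‖) : ‖a‖ ≤ c := by
  have h1 := h a
  rw [real_inner_self_eq_norm_sq, sq] at h1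
  rcases (norm_nonneg a).eq_or_lt with h0 | h0
  · rw [← h0]; exact hc
  · exact le_of_mul_le_mul_right h1 h0

theorem norm_gradx_sub_le {f : E dx × E dy → ℝ} (hf : Differentiable ℝ f) {Lg : ℝ≥0}
    (hL : ∀ p q, ‖fderiv ℝ f p - fderiv ℝ f q‖ ≤ (Lg : ℝ) * ‖p - q‖) (x x' : E dx) (y y' : E dy) :
    ‖gradx f x y - gradx f x' y'‖ ≤ Lg * ‖(x, y) - (x', y')‖ := by
  refine norm_le_of_forall_inner_le (by positivity) fun e => ?_
  rw [inner_sub_left, inner_gradx hf, inner_gradx hf, ← sub_apply]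
  refine (le_abs_self _).trans (((fderiv ℝ f (x, y) - fderiv ℝ f (x', y')).le_opNorm _).trans ?_)
  exact mul_le_mul (hL _ _) (by simp [Prod.norm_def]) (norm_nonneg _) (by positivity)

theorem norm_grady_sub_le {f : E dx × E dy → ℝ} (hf : Differentiable ℝ f) {Lg : ℝ≥0}
    (hL : ∀ p q, ‖fderiv ℝ f p - fderiv ℝ f q‖ ≤ (Lg : ℝ) * ‖p - q‖) (x x' : E dx) (y y' : E dy) :
    ‖grady f x y - grady f x' y'‖ ≤ Lg * ‖(x, y) - (x', y')‖ := by
  refine norm_le_of_forall_inner_le (by positivity) fun e => ?_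
  rw [inner_sub_left, inner_grady hf, inner_grady hf, ← sub_apply]
  refine (le_abs_self _).trans (((fderiv ℝ f (x, y) - fderiv ℝ f (x', y')).le_opNorm _).trans ?_)
  exact mul_le_mul (hL _ _) (by simp [Prod.norm_def]) (norm_nonneg _) (by positivity)

variable {y : E dx → E dy} {L : ℝ≥0} {μ : ℝ}

theorem LipschitzWith.ymu (hy : LipschitzWith L y) (μ : ℝ) : LipschitzWith L (ymu y μ) := by
  have hc := hy.continuous
  refine LipschitzWith.of_dist_le_mul fun a b => ?_
  rw [dist_eq_norm, _root_.ymu, _root_.ymu, ← integral_sub (integrable_uniformBall (by fun_prop))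
    (integrable_uniformBall (by fun_prop))]
  refine (norm_integral_le_of_norm_le_const (C := L * dist a b) (.of_forall fun u => ?_)).trans
    (by simp)
  rw [← dist_eq_norm]
  exact (hy.dist_le_mul _ _).trans (by simp)

theorem norm_ymu_sub_le (hy : LipschitzWith L y) (hμ : 0 ≤ μ) (x : E dx) :
    ‖ymu y μ x - y x‖ ≤ L * μ := by
  have hc := hy.continuous
  have h1 : y x = ∫ _, y x ∂(uniformBall dx) := by simp
  rw [h1, ymu, ← integral_sub (integrable_uniformBall (by fun_prop))
    (integrable_uniformBall (by fun_prop))]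
  refine (norm_integral_le_of_norm_le_const (C := L * μ) ?_).trans (by simp)
  filter_upwards [ae_mem_closedBall_uniformBall dx] with u hu
  rw [← dist_eq_norm]
  refine (hy.dist_le_mul _ _).trans ?_
  rw [mem_closedBall_zero_iff] at hu
  rw [dist_self_add_left, norm_smul, Real.norm_of_nonneg hμ]
  gcongr
  exact mul_le_of_le_one_right hμ hu

theorem differentiable_ymu (hy : LipschitzWith L y) (hμ : μ ≠ 0) : Differentiable ℝ (ymu y μ) :=
  fun x => (hy.hasFDerivAt_integral_uniformBall hμ x).2.differentiableAt

theorem norm_fderiv_ymu_le (hy : LipschitzWith L y) (μ : ℝ) (x : E dx) :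
    ‖fderiv ℝ (ymu y μ) x‖ ≤ L :=
  norm_fderiv_le_of_lipschitz ℝ (hy.ymu μ)

theorem inner_ymu (hy : LipschitzWith L y) (μ : ℝ) (w : E dy) (x : E dx) :
    ⟪w, ymu y μ x⟫ = ∫ u, ⟪w, y (x + μ • u)⟫ ∂(uniformBall dx) := by
  have hc := hy.continuous
  rw [ymu, ← integral_inner (integrable_uniformBall (by fun_prop))]

theorem LipschitzWith.inner_left (hy : LipschitzWith L y) {w : E dy} {C : ℝ≥0} (hw : ‖w‖ ≤ C) :
    LipschitzWith (C * L) fun x => ⟪w, y x⟫ := by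
  refine LipschitzWith.of_dist_le_mul fun a b => ?_
  rw [Real.dist_eq, ← inner_sub_right]
  refine (abs_real_inner_le_norm _ _).trans ?_
  rw [NNReal.coe_mul, mul_assoc, ← dist_eq_norm]
  exact mul_le_mul hw (hy.dist_le_mul _ _) dist_nonneg C.2

theorem hasGradientAt_inner_ymu (hy : LipschitzWith L y) (hμ : μ ≠ 0) (w : E dy) (x : E dx) :
    HasGradientAt (fun x => ∫ u, ⟪w, y (x + μ • u)⟫ ∂(uniformBall dx))
      ((fderiv ℝ (ymu y μ) x).adjoint w) x := by
  simp_rw [← inner_ymu hy]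
  rw [hasGradientAt_iff_hasFDerivAt]
  have h := (innerSL ℝ w).hasFDerivAt.comp x (differentiable_ymu hy hμ x).hasFDerivAt
  refine h.congr_fderiv ?_
  ext e
  simp [ContinuousLinearMap.adjoint_inner_left]

theorem inner_adjoint_fderiv_ymu (hy : LipschitzWith L y) (hμ : μ ≠ 0) (hn : dx ≠ 0) (w : E dy)
    (x e : E dx) : ⟪(fderiv ℝ (ymu y μ) x).adjoint w, e⟫ =
      ∫ v, ⟪(dx / (2 * μ) * (⟪w, y (x + μ • v)⟫ - ⟪w, y (x - μ • v)⟫)) • v, e⟫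
        ∂(uniformSphere dx) := by
  rw [← (hasGradientAt_inner_ymu hy hμ w x).gradient, inner_gradient_left,
    (hy.inner_left (C := ‖w‖₊) le_rfl).fderiv_integral_uniformBall_apply hμ hn]
  simp_rw [real_inner_smul_left]

theorem hasGradientAt_Fmu {f : E dx × E dy → ℝ} (hf : Differentiable ℝ f)
    (hy : LipschitzWith L y) (hμ : μ ≠ 0) (x : E dx) :
    HasGradientAt (Fmu f y μ) (gradx f x (ymu y μ x) +
      (fderiv ℝ (ymu y μ) x).adjoint (grady f x (ymu y μ x))) x := by
  rw [hasGradientAt_iff_hasFDerivAt]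
  have h := (hf (x, ymu y μ x)).hasFDerivAt.comp x
    ((hasFDerivAt_id x).prodMk (differentiable_ymu hy hμ x).hasFDerivAt)
  refine HasFDerivAt.congr_fderiv (f := Fmu f y μ) h ?_
  ext e
  simp only [InnerProductSpace.toDual_apply_apply, inner_add_left, inner_gradx hf,
    ContinuousLinearMap.adjoint_inner_left, inner_grady hf, ← map_add]
  simp

end SmoothedResponse

section StochasticGradient

theorem descent_of_lipschitz_gradient {V : Type*} [NormedAddCommGroup V] [InnerProductSpace ℝ V]
    [CompleteSpace V] {Φ : V → ℝ} {G : V → V} (hΦ : ∀ x, HasGradientAt Φ (G x) x) {K : ℝ}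
    (hG : ∀ a b, ‖G a - G b‖ ≤ K * ‖a - b‖) (x d : V) :
    Φ (x + d) ≤ Φ x + ⟪G x, d⟫ + K / 2 * ‖d‖ ^ 2 := by
  set ψ : ℝ → ℝ := fun t => Φ (x + t • d) - t * ⟪G x, d⟫ - K / 2 * t ^ 2 * ‖d‖ ^ 2 with hψ
  have hd : ∀ t, HasDerivAt ψ (⟪G (x + t • d), d⟫ - ⟪G x, d⟫ - K * t * ‖d‖ ^ 2) t := by
    intro t
    have h1 : HasDerivAt (fun t : ℝ => x + t • d) d t := by
      simpa using ((hasDerivAt_id t).smul_const d).const_add x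
    have h2 := (hΦ (x + t • d)).hasFDerivAt.comp_hasDerivAt t h1
    have h3 : HasDerivAt (fun t : ℝ => t * ⟪G x, d⟫) ⟪G x, d⟫ t := by
      simpa using (hasDerivAt_id t).mul_const ⟪G x, d⟫
    have h4 : HasDerivAt (fun t : ℝ => K / 2 * t ^ 2 * ‖d‖ ^ 2) (K * t * ‖d‖ ^ 2) t := by
      have := ((hasDerivAt_pow 2 t).const_mul (K / 2)).mul_const (‖d‖ ^ 2)
      refine this.congr_deriv ?_
      rw [Nat.add_one_sub_one, pow_one]
      push_cast
      ring
    exact (h2.sub h3).sub h4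
  have hanti : AntitoneOn ψ (Set.Ici 0) := by
    refine antitoneOn_of_deriv_nonpos (convex_Ici 0) (fun t _ => (hd t).continuousAt.continuousWithinAt)
      (fun t _ => (hd t).differentiableAt.differentiableWithinAt) fun t ht => ?_
    rw [interior_Ici, Set.mem_Ioi] at ht
    rw [(hd t).deriv, ← inner_sub_left]
    have h1 := real_inner_le_norm (G (x + t • d) - G x) d
    have h2 := hG (x + t • d) x
    rw [add_sub_cancel_left, norm_smul, Real.norm_of_nonneg ht.le] at h2
    nlinarith [norm_nonneg d]
  have := hanti (Set.mem_Ici.2 le_rfl) (Set.mem_Ici.2 zero_le_one) zero_le_one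
  simp [hψ] at this
  linarith

theorem gradient_eq_zero_of_bounded_below {V : Type*} [NormedAddCommGroup V]
    [InnerProductSpace ℝ V] [CompleteSpace V] {Φ : V → ℝ} {G : V → V}
    (hΦ : ∀ x, HasGradientAt Φ (G x) x) {K D : ℝ} (hG : ∀ a b, ‖G a - G b‖ ≤ K * ‖a - b‖)
    {x₀ : V} (hD : ∀ x, Φ x₀ - Φ x ≤ D) (hDK : D = 0 ∨ K = 0) : G x₀ = 0 := by
  have key : ∀ s : ℝ, s * ‖G x₀‖ ^ 2 - K / 2 * s ^ 2 * ‖G x₀‖ ^ 2 ≤ D := by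
    intro s
    have h1 := descent_of_lipschitz_gradient hΦ hG x₀ (-(s • G x₀))
    rw [inner_neg_right, real_inner_smul_right, real_inner_self_eq_norm_sq, norm_neg, norm_smul,
      mul_pow, Real.norm_eq_abs, sq_abs] at h1
    linarith [hD (x₀ + -(s • G x₀))]
  by_contra hne
  have hpos : 0 < ‖G x₀‖ ^ 2 := by positivity
  rcases hDK with rfl | rfl
  · have h1 := key ((1 + |K|)⁻¹)
    have hK : 0 < 1 + |K| := by positivity
    set s := (1 + |K|)⁻¹ with hs
    have hs0 : 0 < s := by positivity
    have hKs : K * s ≤ 1 := by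
      rw [hs, ← div_eq_mul_inv, div_le_one hK]
      linarith [le_abs_self K]
    have : 0 < s * ‖G x₀‖ ^ 2 := by positivity
    nlinarith
  · have h1 := key ((|D| + 1) / ‖G x₀‖ ^ 2)
    rw [div_mul_cancel₀ _ hpos.ne'] at h1
    linarith [le_abs_self D]

theorem measurePreserving_update_pi {ι : Type*} [Fintype ι] [DecidableEq ι] {Y : ι → Type*}
    [∀ i, MeasurableSpace (Y i)] (ν : ∀ i, Measure (Y i)) [∀ i, IsProbabilityMeasure (ν i)]
    (t : ι) : MeasurePreserving (fun p : (∀ i, Y i) × Y t => Function.update p.1 t p.2)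
      ((Measure.pi ν).prod (ν t)) (Measure.pi ν) := by
  have hm : Measurable fun p : (∀ i, Y i) × Y t => Function.update p.1 t p.2 := by
    refine measurable_pi_lambda _ fun i => ?_
    by_cases h : i = t
    · subst h
      simpa using measurable_snd
    · simp only [Function.update_of_ne h]
      exact (measurable_pi_apply i).comp measurable_fst
  refine ⟨hm, (Measure.pi_eq fun s hs => ?_).symm⟩
  rw [Measure.map_apply hm (.univ_pi hs)]
  have h1 : (fun p : (∀ i, Y i) × Y t => Function.update p.1 t p.2) ⁻¹' Set.univ.pi s
      = (Set.univ.pi (Function.update s t Set.univ)) ×ˢ (s t) := by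
    ext p
    simp only [Set.mem_preimage, Set.mem_univ_pi, Set.mem_prod]
    constructor
    · refine fun h => ⟨fun i => ?_, by simpa using h t⟩
      by_cases hi : i = t
      · subst hi; simp
      · simpa [Function.update_of_ne hi] using h i
    · rintro ⟨h, h'⟩ i
      by_cases hi : i = t
      · subst hi; simpa using h'
      · simpa [Function.update_of_ne hi] using h i
  rw [h1, Measure.prod_prod, Measure.pi_pi, ← Finset.mul_prod_erase _ _ (Finset.mem_univ t),
    ← Finset.mul_prod_erase _ (fun i => ν i (s i)) (Finset.mem_univ t)]
  simp only [Function.update_self, measure_univ, one_mul]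
  rw [mul_comm]
  congr 1
  refine Finset.prod_congr rfl fun i hi => ?_
  rw [Function.update_of_ne (Finset.ne_of_mem_erase hi)]

variable {V : Type*} [NormedAddCommGroup V] [InnerProductSpace ℝ V] [FiniteDimensional ℝ V]
  [MeasurableSpace V] [BorelSpace V] {ν : Measure V} [IsProbabilityMeasure ν] {S : Set V}
  {Φ : V → ℝ} {G : V → V} {K : ℝ} {g : V → V → V} {gbar : V → V} {σ2 c α : ℝ}

theorem expected_descent_step (hS : IsCompact S) (hν : ∀ᵐ v ∂ν, v ∈ S)
    (hΦ : ∀ x, HasGradientAt Φ (G x) x) (hK : 0 ≤ K) (hG : ∀ a b, ‖G a - G b‖ ≤ K * ‖a - b‖)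
    (hg : Continuous (Function.uncurry g)) (hα : 0 ≤ α) {z : V} (hmean : ∫ v, g z v ∂ν = gbar z)
    (hvar : ∫ v, ‖g z v‖ ^ 2 ∂ν ≤ σ2) (hgap : ‖G z - gbar z‖ ≤ c) :
    ∫ v, Φ (z - α • g z v) ∂ν
      ≤ Φ z - α / 2 * ‖G z‖ ^ 2 + (α / 2 * c ^ 2 + K / 2 * α ^ 2 * σ2) := by
  have hΦc : Continuous Φ := continuous_iff_continuousAt.2 fun x => (hΦ x).continuousAt
  have hgz : Continuous (g z) := hg.comp (Continuous.prodMk_right z)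
  have hInt : ∀ {φ : V → ℝ}, Continuous φ → Integrable φ ν :=
    fun hφ => integrable_of_ae_mem_isCompact hS hν hφ
  have hgi : Integrable (g z) ν := integrable_of_ae_mem_isCompact hS hν hgz
  have h1 : ∫ v, Φ (z - α • g z v) ∂ν
      ≤ ∫ v, (Φ z - α * ⟪G z, g z v⟫ + K / 2 * α ^ 2 * ‖g z v‖ ^ 2) ∂ν := by
    refine integral_mono (hInt (by fun_prop)) (hInt (by fun_prop)) fun v => ?_
    have h2 := descent_of_lipschitz_gradient hΦ hG z (-(α • g z v))
    rw [inner_neg_right, real_inner_smul_right, norm_neg, norm_smul, mul_pow, Real.norm_eq_abs,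
      sq_abs, ← sub_eq_add_neg] at h2
    simp only
    linarith
  have h3 : ∫ v, (Φ z - α * ⟪G z, g z v⟫ + K / 2 * α ^ 2 * ‖g z v‖ ^ 2) ∂ν
      = Φ z - α * ⟪G z, gbar z⟫ + K / 2 * α ^ 2 * ∫ v, ‖g z v‖ ^ 2 ∂ν := by
    rw [integral_add (hInt (by fun_prop)) (hInt (by fun_prop)),
      integral_sub (hInt (by fun_prop)) (hInt (by fun_prop)), integral_const_mul,
      integral_const_mul, integral_inner hgi, hmean]
    simp
  have h4 : ‖G z - gbar z‖ ^ 2 = ‖G z‖ ^ 2 - 2 * ⟪G z, gbar z⟫ + ‖gbar z‖ ^ 2 :=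
    norm_sub_sq_real _ _
  have h5 : ‖G z - gbar z‖ ^ 2 ≤ c ^ 2 := pow_le_pow_left₀ (norm_nonneg _) hgap 2
  have h6 : K / 2 * α ^ 2 * ∫ v, ‖g z v‖ ^ 2 ∂ν ≤ K / 2 * α ^ 2 * σ2 := by gcongr
  have h7 : α / 2 * (‖G z‖ ^ 2 - 2 * ⟪G z, gbar z⟫) ≤ α / 2 * c ^ 2 := by
    gcongr
    linarith [sq_nonneg ‖gbar z‖]
  linarith

theorem sum_expected_gradient_sq_le (hS : IsCompact S) (hν : ∀ᵐ v ∂ν, v ∈ S)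
    (hΦ : ∀ x, HasGradientAt Φ (G x) x) (hK : 0 ≤ K) (hG : ∀ a b, ‖G a - G b‖ ≤ K * ‖a - b‖)
    (hg : Continuous (Function.uncurry g)) (hα : 0 ≤ α) (hmean : ∀ z, ∫ v, g z v ∂ν = gbar z)
    (hvar : ∀ z, ∫ v, ‖g z v‖ ^ 2 ∂ν ≤ σ2) (hgap : ∀ z, ‖G z - gbar z‖ ≤ c)
    {x₀ : V} {D : ℝ} (hD : ∀ x, Φ x₀ - Φ x ≤ D) {T : ℕ} {X : ℕ → (Fin T → V) → V}
    (hX0 : ∀ ω, X 0 ω = x₀)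
    (hXstep : ∀ (t : Fin T) ω, X (t + 1) ω = X t ω - α • g (X t ω) (ω t)) :
    α / 2 * ∑ t : Fin T, ∫ ω, ‖G (X t ω)‖ ^ 2 ∂(Measure.pi fun _ : Fin T => ν)
      ≤ D + T * (α / 2 * c ^ 2 + K / 2 * α ^ 2 * σ2) := by
  set P : Measure (Fin T → V) := Measure.pi fun _ : Fin T => ν with hP
  have hΦc : Continuous Φ := continuous_iff_continuousAt.2 fun x => (hΦ x).continuousAt
  have hGc : Continuous G := (LipschitzWith.of_dist_le_mul (K := ⟨K, hK⟩) fun a b => by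
    rw [dist_eq_norm, dist_eq_norm]; exact hG a b).continuous
  have hXc : ∀ k ≤ T, Continuous (X k) := by
    intro k
    induction k with
    | zero => intro _; exact continuous_const.congr fun ω => (hX0 ω).symm
    | succ k ih =>
      intro hk
      have h1 := ih (by omega)
      have h2 : X (k + 1) = fun ω => X k ω - α • Function.uncurry g (X k ω, ω ⟨k, by omega⟩) :=
        funext fun ω => hXstep ⟨k, by omega⟩ ω
      rw [h2]
      fun_prop
  have hXu : ∀ (t : Fin T) (ω : Fin T → V) (v : V), ∀ k ≤ (t : ℕ),
      X k (Function.update ω t v) = X k ω := by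
    intro t ω v k
    induction k with
    | zero => intro _; rw [hX0, hX0]
    | succ k ih =>
      intro hk
      have h1 := hXstep ⟨k, by omega⟩ (Function.update ω t v)
      have h2 := hXstep ⟨k, by omega⟩ ω
      have hne : (⟨k, by omega⟩ : Fin T) ≠ t := by
        intro h
        rw [← h] at hk
        simp at hk
      rw [Function.update_of_ne hne] at h1
      simp only at h1 h2
      rw [h1, h2, ih (by omega)]
  have hPS : ∀ᵐ ω ∂P, ω ∈ Set.univ.pi fun _ : Fin T => S := by
    have h1 : ∀ᵐ ω ∂P, ∀ i, ω i ∈ S :=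
      ae_all_iff.2 fun i => (Measure.tendsto_eval_ae_ae (μ := fun _ : Fin T => ν) (i := i)).eventually hν
    filter_upwards [h1] with ω hω i _ using hω i
  have hSc : IsCompact (Set.univ.pi fun _ : Fin T => S) := isCompact_univ_pi fun _ => hS
  have hInt : ∀ {φ : (Fin T → V) → ℝ}, Continuous φ → Integrable φ P :=
    fun hφ => integrable_of_ae_mem_isCompact hSc hPS hφ
  set C := α / 2 * c ^ 2 + K / 2 * α ^ 2 * σ2 with hC
  have hstep : ∀ k < T, ∫ ω, Φ (X (k + 1) ω) ∂P
      ≤ ∫ ω, Φ (X k ω) ∂P - α / 2 * ∫ ω, ‖G (X k ω)‖ ^ 2 ∂P + C := by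
    intro k hk
    set t : Fin T := ⟨k, hk⟩ with ht
    have hmp := measurePreserving_update_pi (fun _ : Fin T => ν) t
    have hXk := hXc k hk.le
    have hX1 := hXc (k + 1) hk
    have hi1 := hInt (hΦc.comp hX1)
    have hi2 := hmp.integrable_comp_of_integrable hi1
    have h1 : ∫ ω, Φ (X (k + 1) ω) ∂P
        = ∫ ω, ∫ v, Φ (X (k + 1) (Function.update ω t v)) ∂ν ∂P := by
      have h3 : ∫ ω, Φ (X (k + 1) ω) ∂P = ∫ p : (Fin T → V) × V,
          Φ (X (k + 1) (Function.update p.1 t p.2)) ∂(P.prod ν) := by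
        conv_lhs => rw [hP, ← hmp.map_eq]
        exact integral_map hmp.measurable.aemeasurable
          (by rw [hmp.map_eq]; exact hi1.aestronglyMeasurable)
      rw [h3]
      exact integral_prod _ hi2
    have h2 : ∀ ω v, X (k + 1) (Function.update ω t v) = X k ω - α • g (X k ω) v := by
      intro ω v
      have h3 := hXstep t (Function.update ω t v)
      rw [hXu t ω v t le_rfl, Function.update_self] at h3
      exact h3
    have hi3 := hi2.integral_prod_left
    rw [h1]
    simp only [Function.comp_def, h2] at hi3 ⊢
    have hi4 : Integrable (fun ω => Φ (X k ω)) P := hInt (by fun_prop)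
    have hi5 : Integrable (fun ω => α / 2 * ‖G (X k ω)‖ ^ 2) P := hInt (by fun_prop)
    refine (integral_mono hi3 ((hi4.sub hi5).add (integrable_const C)) fun ω =>
      expected_descent_step hS hν hΦ hK hG hg hα (hmean _) (hvar _) (hgap _)).trans ?_
    refine le_of_eq ?_
    have h3 := integral_add (hi4.sub hi5) (integrable_const C)
    have h4 := integral_sub hi4 hi5
    simp only [Pi.sub_apply] at h3 h4
    simp only [Pi.add_apply, Pi.sub_apply]
    rw [h3, h4, integral_const_mul]
    simp
  have hsum : ∀ m ≤ T, ∫ ω, Φ (X m ω) ∂P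
      + α / 2 * ∑ k ∈ Finset.range m, ∫ ω, ‖G (X k ω)‖ ^ 2 ∂P ≤ Φ x₀ + m * C := by
    intro m
    induction m with
    | zero => simp [hX0]
    | succ m ih =>
      intro hm
      rw [Finset.sum_range_succ]
      push_cast
      linarith [ih (by omega), hstep m (by omega)]
  have hlow : Φ x₀ - D ≤ ∫ ω, Φ (X T ω) ∂P := by
    have h1 : ∫ _, (Φ x₀ - D) ∂P ≤ ∫ ω, Φ (X T ω) ∂P :=
      integral_mono (integrable_const _) (hInt (hΦc.comp (hXc T le_rfl))) fun ω => by
        simp only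
        linarith [hD (X T ω)]
    simpa using h1
  have := hsum T le_rfl
  rw [Finset.sum_range] at this
  linarith

end StochasticGradient

section Estimator

variable {dx dy : ℕ} {f : E dx × E dy → ℝ} {Lf Lg L : ℝ≥0} {y : E dx → E dy} {μ : ℝ}

theorem ContinuousLinearMap.norm_adjoint_apply_le {V W : Type*} [NormedAddCommGroup V]
    [InnerProductSpace ℝ V] [CompleteSpace V] [NormedAddCommGroup W] [InnerProductSpace ℝ W]
    [CompleteSpace W] (A : V →L[ℝ] W) (w : W) : ‖A.adjoint w‖ ≤ ‖A‖ * ‖w‖ := by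
  refine (A.adjoint.le_opNorm w).trans_eq ?_
  rw [LinearIsometryEquiv.norm_map]

theorem adjoint_smul_smulRight_apply {V W : Type*} [NormedAddCommGroup V]
    [InnerProductSpace ℝ V] [CompleteSpace V] [NormedAddCommGroup W] [InnerProductSpace ℝ W]
    [CompleteSpace W] (c : ℝ) (v : V) (a w : W) :
    (c • (innerSL ℝ v).smulRight a).adjoint w = (c * ⟪w, a⟫) • v := by
  refine ext_inner_right ℝ fun e => ?_
  rw [ContinuousLinearMap.adjoint_inner_left]
  simp [inner_smul_left, inner_smul_right]
  ring

theorem continuous_gradx (hf : Differentiable ℝ f)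
    (hL : ∀ p q, ‖fderiv ℝ f p - fderiv ℝ f q‖ ≤ (Lg : ℝ) * ‖p - q‖) :
    Continuous fun p : E dx × E dy => gradx f p.1 p.2 :=
  (LipschitzWith.of_dist_le_mul (K := Lg) fun p q => by
    rw [dist_eq_norm, dist_eq_norm]
    exact norm_gradx_sub_le hf hL p.1 q.1 p.2 q.2).continuous

theorem continuous_grady (hf : Differentiable ℝ f)
    (hL : ∀ p q, ‖fderiv ℝ f p - fderiv ℝ f q‖ ≤ (Lg : ℝ) * ‖p - q‖) :
    Continuous fun p : E dx × E dy => grady f p.1 p.2 :=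
  (LipschitzWith.of_dist_le_mul (K := Lg) fun p q => by
    rw [dist_eq_norm, dist_eq_norm]
    exact norm_grady_sub_le hf hL p.1 q.1 p.2 q.2).continuous

theorem norm_gradient_Fmu_sub_le (hf : Differentiable ℝ f)
    (hgrady : ∀ x y, ‖grady f x y‖ ≤ (Lf : ℝ))
    (hL : ∀ p q, ‖fderiv ℝ f p - fderiv ℝ f q‖ ≤ (Lg : ℝ) * ‖p - q‖)
    (hy : LipschitzWith L y) (hμ : μ ≠ 0) {κ : ℝ}
    (hκ : ∀ (C : ℝ≥0) (h : E dx → ℝ), LipschitzWith C h → ∀ a b : E dx,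
      ‖gradient (fun x => ∫ u, h (x + μ • u) ∂(uniformBall dx)) a
          - gradient (fun x => ∫ u, h (x + μ • u) ∂(uniformBall dx)) b‖ ≤ κ * C * ‖a - b‖)
    (a b : E dx) :
    ‖gradient (Fmu f y μ) a - gradient (Fmu f y μ) b‖
      ≤ (Lg * (1 + L) ^ 2 + κ * (Lf * L)) * ‖a - b‖ := by
  rw [(hasGradientAt_Fmu hf hy hμ a).gradient, (hasGradientAt_Fmu hf hy hμ b).gradient]
  set Ja := fderiv ℝ (ymu y μ) a
  set Jb := fderiv ℝ (ymu y μ) b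
  set wa := grady f a (ymu y μ a)
  set wb := grady f b (ymu y μ b)
  have hpair : ‖(a, ymu y μ a) - (b, ymu y μ b)‖ ≤ (1 + L) * ‖a - b‖ := by
    have h1 := (hy.ymu μ).dist_le_mul a b
    rw [dist_eq_norm, dist_eq_norm] at h1
    rw [Prod.mk_sub_mk, Prod.norm_mk, max_le_iff]
    have := norm_nonneg (a - b)
    have := mul_nonneg L.2 (norm_nonneg (a - b))
    constructor <;> nlinarith
  have h1 : ‖gradx f a (ymu y μ a) - gradx f b (ymu y μ b)‖ ≤ Lg * ((1 + L) * ‖a - b‖) :=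
    (norm_gradx_sub_le hf hL _ _ _ _).trans (by gcongr)
  have h2 : ‖Ja.adjoint (wa - wb)‖ ≤ L * (Lg * ((1 + L) * ‖a - b‖)) := by
    refine (Ja.norm_adjoint_apply_le _).trans (mul_le_mul (norm_fderiv_ymu_le hy μ a) ?_
      (norm_nonneg _) L.2)
    exact (norm_grady_sub_le hf hL _ _ _ _).trans (by gcongr)
  have h3 : ‖Ja.adjoint wb - Jb.adjoint wb‖ ≤ κ * (Lf * L) * ‖a - b‖ := by
    have h4 := hκ (Lf * L) _ (hy.inner_left (hgrady b (ymu y μ b))) a b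
    rw [(hasGradientAt_inner_ymu hy hμ _ a).gradient,
      (hasGradientAt_inner_ymu hy hμ _ b).gradient] at h4
    exact h4
  have h5 : gradx f a (ymu y μ a) + Ja.adjoint wa - (gradx f b (ymu y μ b) + Jb.adjoint wb)
      = (gradx f a (ymu y μ a) - gradx f b (ymu y μ b)) + Ja.adjoint (wa - wb)
        + (Ja.adjoint wb - Jb.adjoint wb) := by
    rw [map_sub]
    abel
  rw [h5]
  refine norm_add₃_le.trans ((add_le_add_three h1 h2 h3).trans_eq ?_)
  ring

theorem norm_gradient_Fmu_sub_adjoint_le (hf : Differentiable ℝ f)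
    (hL : ∀ p q, ‖fderiv ℝ f p - fderiv ℝ f q‖ ≤ (Lg : ℝ) * ‖p - q‖)
    (hy : LipschitzWith L y) (hμ : 0 < μ) (z : E dx) :
    ‖gradient (Fmu f y μ) z - (gradx f z (y z) +
      (fderiv ℝ (ymu y μ) z).adjoint (grady f z (y z)))‖ ≤ Lg * (1 + L) * L * μ := by
  rw [(hasGradientAt_Fmu hf hy hμ.ne' z).gradient]
  set J := fderiv ℝ (ymu y μ) z
  have hpair : ‖(z, ymu y μ z) - (z, y z)‖ ≤ L * μ := by
    rw [Prod.mk_sub_mk, Prod.norm_mk, sub_self, norm_zero, max_eq_right (norm_nonneg _)]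
    exact norm_ymu_sub_le hy hμ.le z
  have h1 : ‖gradx f z (ymu y μ z) - gradx f z (y z)‖ ≤ Lg * (L * μ) :=
    (norm_gradx_sub_le hf hL _ _ _ _).trans (by gcongr)
  have h2 : ‖J.adjoint (grady f z (ymu y μ z) - grady f z (y z))‖ ≤ L * (Lg * (L * μ)) := by
    refine (J.norm_adjoint_apply_le _).trans (mul_le_mul (norm_fderiv_ymu_le hy μ z) ?_
      (norm_nonneg _) L.2)
    exact (norm_grady_sub_le hf hL _ _ _ _).trans (by gcongr)
  rw [add_sub_add_comm, ← map_sub]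
  refine (norm_add_le _ _).trans ((add_le_add h1 h2).trans_eq ?_)
  ring

theorem integral_two_point_estimator (hy : LipschitzWith L y) (hμ : μ ≠ 0) (hn : dx ≠ 0)
    (w : E dy) (z : E dx) :
    ∫ v, (dx / (2 * μ) * (⟪w, y (z + μ • v)⟫ - ⟪w, y (z - μ • v)⟫)) • v ∂(uniformSphere dx)
      = (fderiv ℝ (ymu y μ) z).adjoint w := by
  have hc := hy.continuous
  refine ext_inner_right ℝ fun e => ?_
  rw [inner_adjoint_fderiv_ymu hy hμ hn, real_inner_comm,
    ← integral_inner (integrable_uniformSphere (by fun_prop))]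
  simp_rw [real_inner_comm]

theorem integral_gradient_estimator (hy : LipschitzWith L y) (hμ : μ ≠ 0) (hn : dx ≠ 0)
    (p : E dx) (w : E dy) (z : E dx) :
    ∫ v, (p + (dx / (2 * μ) * (⟪w, y (z + μ • v)⟫ - ⟪w, y (z - μ • v)⟫)) • v) ∂(uniformSphere dx)
      = p + (fderiv ℝ (ymu y μ) z).adjoint w := by
  have := isProbabilityMeasure_uniformSphere hn
  have hc := hy.continuous
  rw [integral_add (integrable_const _) (integrable_uniformSphere (by fun_prop)),
    integral_two_point_estimator hy hμ hn]
  simp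

theorem integral_norm_sq_gradient_estimator_le (hy : LipschitzWith L y) (hμ : μ ≠ 0) (hn : dx ≠ 0)
    {p : E dx} {w : E dy} (hp : ‖p‖ ≤ Lf) (hw : ‖w‖ ≤ Lf) {k : ℝ} (z : E dx)
    (hk : ∀ (C : ℝ≥0) (h : E dx → ℝ), LipschitzWith C h →
      ∫ v, ‖((dx : ℝ) / (2 * μ) * (h (z + μ • v) - h (z - μ • v))) • v‖ ^ 2 ∂(uniformSphere dx)
        ≤ k * dx * (C : ℝ) ^ 2) :
    ∫ v, ‖p + (dx / (2 * μ) * (⟪w, y (z + μ • v)⟫ - ⟪w, y (z - μ • v)⟫)) • v‖ ^ 2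
        ∂(uniformSphere dx)
      ≤ k * dx * (Lf : ℝ) ^ 2 * (L : ℝ) ^ 2 + (Lf : ℝ) ^ 2 * (1 + 2 * L) := by
  have := isProbabilityMeasure_uniformSphere hn
  have hc := hy.continuous
  have hq : Continuous fun v : E dx =>
    ((dx : ℝ) / (2 * μ) * (⟪w, y (z + μ • v)⟫ - ⟪w, y (z - μ • v)⟫)) • v := by fun_prop
  have h1 := hk (Lf * L) _ (hy.inner_left hw)
  have h2 := integral_two_point_estimator hy hμ hn w z
  set q : E dx → E dx := fun v =>
    ((dx : ℝ) / (2 * μ) * (⟪w, y (z + μ • v)⟫ - ⟪w, y (z - μ • v)⟫)) • v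
  change ∫ v, q v ∂_ = _ at h2
  change ∫ v, ‖q v‖ ^ 2 ∂_ ≤ _ at h1
  change ∫ v, ‖p + q v‖ ^ 2 ∂_ ≤ _
  have h3 : ‖(fderiv ℝ (ymu y μ) z).adjoint w‖ ≤ L * Lf :=
    (ContinuousLinearMap.norm_adjoint_apply_le _ _).trans
      (mul_le_mul (norm_fderiv_ymu_le hy μ z) hw (norm_nonneg _) L.2)
  have h4 : ∫ v, ‖p + q v‖ ^ 2 ∂(uniformSphere dx)
      = ‖p‖ ^ 2 + 2 * ⟪p, (fderiv ℝ (ymu y μ) z).adjoint w⟫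
        + ∫ v, ‖q v‖ ^ 2 ∂(uniformSphere dx) := by
    simp_rw [norm_add_sq_real]
    rw [integral_add (integrable_uniformSphere (by fun_prop))
      (integrable_uniformSphere (by fun_prop)), integral_add (integrable_const _)
      (integrable_uniformSphere (by fun_prop)), integral_const_mul,
      integral_inner (integrable_uniformSphere hq), h2]
    simp
  have h5 : ⟪p, (fderiv ℝ (ymu y μ) z).adjoint w⟫ ≤ Lf * (L * Lf) :=
    (real_inner_le_norm _ _).trans (mul_le_mul hp h3 (norm_nonneg _) Lf.2)
  have h6 : ‖p‖ ^ 2 ≤ (Lf : ℝ) ^ 2 := pow_le_pow_left₀ (norm_nonneg _) hp 2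
  rw [h4]
  push_cast at h1
  linarith

theorem Fmu_sub_Fmu_le (hf : LipschitzWith Lf f) (hy : LipschitzWith L y) (hμ : 0 ≤ μ)
    {x₀ : E dx} {Δ : ℝ} (hΔ : ∀ x, f (x₀, y x₀) - f (x, y x) ≤ Δ) (x : E dx) :
    Fmu f y μ x₀ - Fmu f y μ x ≤ Δ + 2 * Lf * L * μ := by
  have key : ∀ z, |Fmu f y μ z - f (z, y z)| ≤ Lf * (L * μ) := by
    intro z
    have h1 := hf.dist_le_mul (z, ymu y μ z) (z, y z)
    rw [Prod.dist_eq, dist_self, max_eq_right dist_nonneg, dist_eq_norm (ymu y μ z)] at h1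
    refine h1.trans ?_
    gcongr
    exact norm_ymu_sub_le hy hμ z
  linarith [hΔ x, (abs_le.1 (key x₀)).2, (abs_le.1 (key x)).1]

theorem average_le_of_stepsize {T D K s c α S : ℝ} (hT : 0 < T) (hD : 0 < D) (hK : 0 < K)
    (hs : 0 < s) (hα : α = √(2 * D / (T * K * s)))
    (h : α / 2 * S ≤ D + T * (α / 2 * c ^ 2 + K / 2 * α ^ 2 * s)) :
    1 / T * S ≤ 2 * √(2 * D * K * s / T) + c ^ 2 := by
  have hα0 : 0 < α := by rw [hα]; positivity
  have hα2 : T * K * s * α ^ 2 = 2 * D := by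
    rw [hα, Real.sq_sqrt (by positivity)]
    field_simp
  have hprod : T * (α * √(2 * D * K * s / T)) = 2 * D := by
    rw [hα, ← Real.sqrt_mul (by positivity)]
    have h1 : 2 * D / (T * K * s) * (2 * D * K * s / T) = (2 * D / T) ^ 2 := by field_simp
    rw [h1, Real.sqrt_sq (by positivity)]
    field_simp
  rw [one_div, inv_mul_le_iff₀ hT]
  refine le_of_mul_le_mul_left ?_ (half_pos hα0)
  linarith

end Estimator

/-- averaged expected squared gradient norm bound for the smoothed surrogate `F_μ` along the PZOS iterates. -/
theorem stmt17 (dx dy : ℕ) (f : E dx × E dy → ℝ) (Lf Lg : ℝ≥0)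
    (hfdiff : Differentiable ℝ f) (hfLip : LipschitzWith Lf f)
    (hgradx : ∀ (x : E dx) (y : E dy), ‖gradx f x y‖ ≤ (Lf : ℝ))
    (hgrady : ∀ (x : E dx) (y : E dy), ‖grady f x y‖ ≤ (Lf : ℝ))
    (hgradLip : ∀ p q : E dx × E dy, ‖fderiv ℝ f p - fderiv ℝ f q‖ ≤ (Lg : ℝ) * ‖p - q‖)
    (ystar : E dx → E dy) (Ly : ℝ≥0) (hLip : LipschitzWith Ly ystar)
    (μ : ℝ) (hμ : 0 < μ) (k1 k2 : ℝ) (hk1pos : 0 < k1) (hk2pos : 0 < k2)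
    (hk1 : ∀ (L : ℝ≥0) (h : E dx → ℝ), LipschitzWith L h →
      ∀ a b : E dx,
        ‖gradient (fun x => ∫ u, h (x + μ • u) ∂(uniformBall dx)) a
          - gradient (fun x => ∫ u, h (x + μ • u) ∂(uniformBall dx)) b‖
        ≤ k1 * (L : ℝ) * Real.sqrt dx / μ * ‖a - b‖)
    (hk2 : ∀ (L : ℝ≥0) (h : E dx → ℝ), LipschitzWith L h →
      ∀ z : E dx,
        (∫ v, ‖(((dx : ℝ) / (2 * μ)) * (h (z + μ • v) - h (z - μ • v))) • v‖ ^ 2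
          ∂(uniformSphere dx))
        ≤ k2 * (dx : ℝ) * (L : ℝ) ^ 2)
    (LF Cp sig2 : ℝ)
    (hLF : LF = (Lg : ℝ) * (1 + (Ly : ℝ)) ^ 2 + k1 * (Lf : ℝ) * (Ly : ℝ) * Real.sqrt dx / μ)
    (hCp : Cp = (Lg : ℝ) * (1 + (Ly : ℝ)) * (Ly : ℝ))
    (hsig2 : sig2 = k2 * (dx : ℝ) * (Lf : ℝ) ^ 2 * (Ly : ℝ) ^ 2
      + (Lf : ℝ) ^ 2 * (1 + 2 * (Ly : ℝ)))
    (x0 : E dx) (Δ : ℝ)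
    (hΔ : ∀ x : E dx, f (x0, ystar x0) - f (x, ystar x) ≤ Δ)
    (T : ℕ) (hT : 1 ≤ T) (α : ℝ)
    (hα : α = Real.sqrt (2 * (Δ + 2 * (Lf : ℝ) * (Ly : ℝ) * μ) / ((T : ℝ) * LF * sig2)))
    (g : E dx → E dx → E dx)
    (hg : ∀ z v : E dx,
      g z v = gradx f z (ystar z)
        + (ContinuousLinearMap.adjoint
            (((dx : ℝ) / (2 * μ)) •
              ((innerSL ℝ v).smulRight (ystar (z + μ • v) - ystar (z - μ • v)))))
            (grady f z (ystar z)))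
    (X : ℕ → (Fin T → E dx) → E dx)
    (hX0 : ∀ ω : Fin T → E dx, X 0 ω = x0)
    (hXstep : ∀ (t : Fin T) (ω : Fin T → E dx),
      X ((t : ℕ) + 1) ω = X (t : ℕ) ω - α • g (X (t : ℕ) ω) (ω t))
    (gbar : E dx → E dx)
    (hgbar : ∀ z : E dx,
      gbar z = gradx f z (ystar z)
        + (ContinuousLinearMap.adjoint (fderiv ℝ (ymu ystar μ) z)) (grady f z (ystar z))) :
    (1 / (T : ℝ)) * ∑ t : Fin T,
      ∫ ω, ‖gradient (Fmu f ystar μ) (X (t : ℕ) ω)‖ ^ 2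
        ∂(Measure.pi fun _ : Fin T => uniformSphere dx)
      ≤ 2 * Real.sqrt (2 * (Δ + 2 * (Lf : ℝ) * (Ly : ℝ) * μ) * LF * sig2 / (T : ℝ))
        + Cp ^ 2 * μ ^ 2 := by
  have hΔ0 : 0 ≤ Δ := by simpa using hΔ x0
  set D := Δ + 2 * (Lf : ℝ) * (Ly : ℝ) * μ with hDdef
  have hD0 : 0 ≤ D := by positivity
  have hLF0 : 0 ≤ LF := by rw [hLF]; positivity
  have hsig0 : (Lf : ℝ) ^ 2 ≤ sig2 := by
    rw [hsig2]
    have : 0 ≤ k2 * (dx : ℝ) * (Lf : ℝ) ^ 2 * (Ly : ℝ) ^ 2 := by positivity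
    have : 0 ≤ (Lf : ℝ) ^ 2 * (2 * (Ly : ℝ)) := by positivity
    linarith
  have hs0 : 0 ≤ sig2 := (sq_nonneg _).trans hsig0
  have hTpos : (0 : ℝ) < T := by exact_mod_cast hT
  have hΦ : ∀ x, HasGradientAt (Fmu f ystar μ) (gradient (Fmu f ystar μ) x) x := fun x =>
    (hasGradientAt_Fmu hfdiff hLip hμ.ne' x).differentiableAt.hasGradientAt
  have hG : ∀ a b, ‖gradient (Fmu f ystar μ) a - gradient (Fmu f ystar μ) b‖ ≤ LF * ‖a - b‖ := by
    intro a b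
    refine (norm_gradient_Fmu_sub_le (κ := k1 * √dx / μ) hfdiff hgrady hgradLip hLip hμ.ne'
      (fun C h hh a b => (hk1 C h hh a b).trans_eq (by ring)) a b).trans_eq ?_
    rw [hLF]
    ring
  have hDx : ∀ x, Fmu f ystar μ x0 - Fmu f ystar μ x ≤ D :=
    Fmu_sub_Fmu_le hfLip hLip hμ.le hΔ
  have hRHS : 0 ≤ 2 * √(2 * D * LF * sig2 / T) + Cp ^ 2 * μ ^ 2 := by positivity
  by_cases hdeg : dx = 0 ∨ Lf = 0 ∨ D = 0 ∨ LF = 0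
  · refine le_of_eq_of_le ?_ hRHS
    have hzero : ∀ (t : Fin T) ω, gradient (Fmu f ystar μ) (X t ω) = 0 := by
      rcases hdeg with h | h | h
      · subst h
        intro t ω
        exact Subsingleton.elim _ _
      · subst h
        intro t ω
        rw [(hasGradientAt_Fmu hfdiff hLip hμ.ne' _).gradient,
          norm_le_zero_iff.1 (hgradx _ _), norm_le_zero_iff.1 (hgrady _ _), map_zero, add_zero]
      · have hα0 : α = 0 := by
          rw [hα]
          rcases h with h | h <;> simp [h]
        have hX : ∀ k ≤ T, ∀ ω, X k ω = x0 := by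
          intro k
          induction k with
          | zero => exact fun _ => hX0
          | succ k ih =>
            intro hk ω
            have h1 := hXstep ⟨k, hk⟩ ω
            simp only [hα0, zero_smul, sub_zero] at h1
            rw [h1, ih (by omega)]
        intro t ω
        rw [hX t t.2.le]
        exact gradient_eq_zero_of_bounded_below hΦ hG hDx h
    simp [hzero]
  · push Not at hdeg
    obtain ⟨hn, hLf, hD, hLFne⟩ := hdeg
    have hprob := isProbabilityMeasure_uniformSphere hn
    have hs : 0 < sig2 := lt_of_lt_of_le (by positivity) hsig0
    have hg' : ∀ z v, g z v = gradx f z (ystar z) + ((dx : ℝ) / (2 * μ) *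
        (⟪grady f z (ystar z), ystar (z + μ • v)⟫ - ⟪grady f z (ystar z), ystar (z - μ • v)⟫))
          • v := by
      intro z v
      rw [hg, adjoint_smul_smulRight_apply, inner_sub_right]
    have hgc : Continuous (Function.uncurry g) := by
      have hyc := hLip.continuous
      have h1 : Continuous fun p : E dx × E dx => gradx f p.1 (ystar p.1) :=
        (continuous_gradx hfdiff hgradLip).comp
          (g := fun p : E dx × E dy => gradx f p.1 p.2) (f := fun p : E dx × E dx => (p.1, ystar p.1))
          (by fun_prop)
      have h2 : Continuous fun p : E dx × E dx => grady f p.1 (ystar p.1) :=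
        (continuous_grady hfdiff hgradLip).comp
          (g := fun p : E dx × E dy => grady f p.1 p.2) (f := fun p : E dx × E dx => (p.1, ystar p.1))
          (by fun_prop)
      have h3 : Function.uncurry g = fun p => _ := funext fun p => hg' p.1 p.2
      rw [h3]
      fun_prop
    have hmain := sum_expected_gradient_sq_le (c := Cp * μ) (isCompact_sphere (0 : E dx) 1)
      (ae_mem_sphere_uniformSphere dx) hΦ hLF0 hG hgc (hα ▸ Real.sqrt_nonneg _)
      (gbar := gbar) (σ2 := sig2) (fun z => ?_) (fun z => ?_) (fun z => ?_) hDx hX0 hXstep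
    · rw [← mul_pow]
      exact average_le_of_stepsize hTpos (lt_of_le_of_ne hD0 hD.symm)
        (lt_of_le_of_ne hLF0 hLFne.symm) hs hα hmain
    · simp_rw [hg']
      rw [hgbar]
      exact integral_gradient_estimator hLip hμ.ne' hn _ _ z
    · simp_rw [hg']
      rw [hsig2]
      exact integral_norm_sq_gradient_estimator_le hLip hμ.ne' hn (hgradx _ _) (hgrady _ _) z
        fun C h hh => hk2 C h hh z
    · rw [hgbar, hCp]
      exact norm_gradient_Fmu_sub_adjoint_le hfdiff hgradLip hLip hμ z
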